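/- Let v ∈ BV⁺(Ω). Then for every k > 0 the truncation w = min(v, k) belongs to BV⁺(Ω), and for almost every k > 0 such that the set A(k) = { x ∈ Ω : v(x) > k } has positive Lebesgue measure, the strict inequality F(min(v,k)) < F(v) holds. -/

import Mathlib

open MeasureTheory
open scoped ENNReal

/-- A family `g = (g₁, …, g_{n+1})` of test vector fields for the weighted area
functional: each `gᵢ` is `C¹` with compact support contained in `Ω`, and
`∑ᵢ gᵢ(x)² ≤ 1` for every `x`. -/
def Admissible (n : ℕ) (Ω : Set (EuclideanSpace ℝ (Fin n)))
    (g : Fin (n + 1) → EuclideanSpace ℝ (Fin n) → ℝ) : Prop :=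
  (∀ i, ContDiff ℝ 1 (g i)) ∧ (∀ i, HasCompactSupport (g i)) ∧
    (∀ i, tsupport (g i) ⊆ Ω) ∧ ∀ x, ∑ i, g i x ^ 2 ≤ 1

/-- `F(v) = ∫_Ω √(v² + |Dv|²)`, defined by duality as a value in `[0, ∞]`. -/
noncomputable def Ffun (n : ℕ) (Ω : Set (EuclideanSpace ℝ (Fin n)))
    (v : EuclideanSpace ℝ (Fin n) → ℝ) : ℝ≥0∞ :=
  ⨆ g : { g // Admissible n Ω g },
    ENNReal.ofReal (∫ x in Ω, v x * (g.1 (Fin.last n) x +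
      ∑ i : Fin n, fderiv ℝ (g.1 i.castSucc) x (EuclideanSpace.single i 1)))

/-- `A(v) = ∫_Ω √(1 + |Dv|²)`, the area functional, defined by duality. -/
noncomputable def Afun (n : ℕ) (Ω : Set (EuclideanSpace ℝ (Fin n)))
    (v : EuclideanSpace ℝ (Fin n) → ℝ) : ℝ≥0∞ :=
  ⨆ g : { g // Admissible n Ω g },
    ENNReal.ofReal (∫ x in Ω, (g.1 (Fin.last n) x +
      v x * ∑ i : Fin n, fderiv ℝ (g.1 i.castSucc) x (EuclideanSpace.single i 1)))

/-- Test fields for the total variation: `n` components. -/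
def AdmissibleT (n : ℕ) (Ω : Set (EuclideanSpace ℝ (Fin n)))
    (g : Fin n → EuclideanSpace ℝ (Fin n) → ℝ) : Prop :=
  (∀ i, ContDiff ℝ 1 (g i)) ∧ (∀ i, HasCompactSupport (g i)) ∧
    (∀ i, tsupport (g i) ⊆ Ω) ∧ ∀ x, ∑ i, g i x ^ 2 ≤ 1

/-- `T(v) = ∫_Ω |Dv|`, the total variation, defined by duality. -/
noncomputable def Tfun (n : ℕ) (Ω : Set (EuclideanSpace ℝ (Fin n)))
    (v : EuclideanSpace ℝ (Fin n) → ℝ) : ℝ≥0∞ :=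
  ⨆ g : { g // AdmissibleT n Ω g },
    ENNReal.ofReal (∫ x in Ω,
      v x * ∑ i : Fin n, fderiv ℝ (g.1 i) x (EuclideanSpace.single i 1))

open Set Filter Topology Convolution

/-- A smooth approximation of the truncation `t ↦ min t k`, together with the complement `ψ` of its
derivative. -/
lemma exists_smooth_truncation (k : ℝ) {e : ℝ} (he : 0 < e) :
    ∃ ψ Ψ : ℝ → ℝ, ContDiff ℝ 1 ψ ∧ (∀ t, 0 ≤ ψ t) ∧ (∀ t, ψ t ≤ 1) ∧
      (∀ t ≤ k, ψ t = 0) ∧ (∀ t, k + e ≤ t → ψ t = 1) ∧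
      (∀ t, HasDerivAt Ψ (1 - ψ t) t) ∧ (∀ t ≤ k, Ψ t = t) ∧
      (∀ t, k ≤ t → k ≤ Ψ t ∧ Ψ t ≤ k + e) := by
  set ψ : ℝ → ℝ := fun t => Real.smoothTransition ((t - k) / e) with hψ
  have hψc : ContDiff ℝ 1 ψ := Real.smoothTransition.contDiff.comp (by fun_prop)
  have hcont : Continuous fun t => 1 - ψ t := continuous_const.sub hψc.continuous
  have hint : ∀ a b, IntervalIntegrable (fun t => 1 - ψ t) volume a b :=
    fun a b => hcont.intervalIntegrable a b
  have h0 : ∀ t, 0 ≤ ψ t := fun t => Real.smoothTransition.nonneg _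
  have h1 : ∀ t, ψ t ≤ 1 := fun t => Real.smoothTransition.le_one _
  have hz : ∀ t ≤ k, ψ t = 0 := fun t ht =>
    Real.smoothTransition.zero_of_nonpos (div_nonpos_of_nonpos_of_nonneg (by linarith) he.le)
  have ho : ∀ t, k + e ≤ t → ψ t = 1 := fun t ht =>
    Real.smoothTransition.one_of_one_le (by rw [le_div_iff₀ he]; linarith)
  have hle : ∀ t, k ≤ t → ∫ s in k..t, (1 - ψ s) ≤ t - k := fun t ht => by
    calc ∫ s in k..t, (1 - ψ s) ≤ ∫ _ in k..t, (1 : ℝ) :=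
          intervalIntegral.integral_mono_on ht (hint _ _) (by simp)
            (fun s _ => by linarith [h0 s])
      _ = t - k := by simp
  refine ⟨ψ, fun t => k + ∫ s in k..t, (1 - ψ s), hψc, h0, h1, hz, ho, fun t => ?_,
    fun t ht => ?_, fun t ht => ⟨?_, ?_⟩⟩
  · exact (hcont.integral_hasStrictDerivAt k t).hasDerivAt.const_add k
  · have : ∫ s in k..t, (1 - ψ s) = ∫ _ in k..t, (1 : ℝ) := by
      refine intervalIntegral.integral_congr fun s hs => ?_
      rw [uIcc_of_ge ht] at hs
      simp [hz s hs.2]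
    simp [this]
  · have := intervalIntegral.integral_nonneg (μ := volume) ht
      (fun s _ => sub_nonneg.2 (h1 s))
    linarith
  · rcases le_total t (k + e) with h | h
    · linarith [hle t ht]
    · have hs := intervalIntegral.integral_add_adjacent_intervals (hint k (k + e)) (hint (k + e) t)
      have : ∫ s in (k + e)..t, (1 - ψ s) = ∫ _ in (k + e)..t, (0 : ℝ) := by
        refine intervalIntegral.integral_congr fun s hs => ?_
        rw [uIcc_of_le h] at hs
        simp [ho s hs.1]
      rw [this] at hs
      simp only [intervalIntegral.integral_zero, add_zero] at hs
      linarith [hle (k + e) (by linarith)]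

lemma truncation_pointwise_le {k e t s P a b D : ℝ} (hk : 0 < k) (he : 0 < e)
    (ht : 0 ≤ t) (hs0 : 0 ≤ s) (hs1 : s ≤ 1) (hsz : t ≤ k → s = 0) (hso : k + e ≤ t → s = 1)
    (hP : t ≤ k → P = t) (hP' : k ≤ t → k ≤ P ∧ P ≤ k + e) (hab : |a| ≤ b) :
    min t k * (a + D) + max (min t (k + 1) - k) 0 * b ≤
      t * ((1 - s) * a + s * b) + P * D + e * (|D| + 2 * b) := by
  have hb : 0 ≤ b := (abs_nonneg a).trans hab
  obtain ⟨ha1, ha2⟩ := abs_le.1 hab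
  rcases le_total t k with h | h
  · rw [hsz h, hP h, min_eq_left h, min_eq_left (by linarith : t ≤ k + 1),
      max_eq_right (by linarith : t - k ≤ 0)]
    have : 0 ≤ e * (|D| + 2 * b) := by positivity
    linarith
  · obtain ⟨hp1, hp2⟩ := hP' h
    rw [min_eq_right h]
    set m := min t (k + 1) with hm
    have hmt : m ≤ t := min_le_left _ _
    have hmk : k ≤ m := le_min h (by linarith)
    rw [max_eq_left (by linarith : 0 ≤ m - k)]
    have hkey : (t - k) * (1 - s) ≤ e := by
      rcases le_total (k + e) t with h' | h'
      · rw [hso h']; linarith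
      · nlinarith
    have hD : (k - P) * D ≤ e * |D| := by
      have h1 : (k - P) * D ≤ |(k - P)| * |D| := by rw [← abs_mul]; exact le_abs_self _
      have h2 : |k - P| ≤ e := abs_le.2 ⟨by linarith, by linarith⟩
      exact h1.trans (mul_le_mul_of_nonneg_right h2 (abs_nonneg _))
    have hA : -(e * b) ≤ (t - k) * (1 - s) * a := by
      have h1 : 0 ≤ (t - k) * (1 - s) := mul_nonneg (by linarith) (by linarith)
      nlinarith
    have hB : (m - k) * (1 - s) * b ≤ e * b := by
      refine mul_le_mul_of_nonneg_right (le_trans ?_ hkey) hb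
      exact mul_le_mul_of_nonneg_right (by linarith) (by linarith)
    have hC : 0 ≤ k * s * (b - a) := mul_nonneg (mul_nonneg hk.le hs0) (by linarith)
    have hE : 0 ≤ (t - m) * s * b := mul_nonneg (mul_nonneg (by linarith) hs0) hb
    nlinarith

/-- The scalar field `g_{n+1} + div (g₁, …, gₙ)` tested against `v` in the definition of `F v`. -/
noncomputable def testField {n : ℕ} (g : Fin (n + 1) → EuclideanSpace ℝ (Fin n) → ℝ)
    (x : EuclideanSpace ℝ (Fin n)) : ℝ :=
  g (Fin.last n) x + ∑ i : Fin n, fderiv ℝ (g i.castSucc) x (EuclideanSpace.single i 1)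

section
variable {n : ℕ} {Ω : Set (EuclideanSpace ℝ (Fin n))}
  {g : Fin (n + 1) → EuclideanSpace ℝ (Fin n) → ℝ}

lemma Admissible.continuous_fderiv (hg : Admissible n Ω g) (i : Fin (n + 1))
    (w : EuclideanSpace ℝ (Fin n)) : Continuous fun x => fderiv ℝ (g i) x w :=
  ((hg.1 i).continuous_fderiv one_ne_zero).clm_apply continuous_const

lemma Admissible.continuous_testField (hg : Admissible n Ω g) : Continuous (testField g) :=
  (hg.1 _).continuous.add (continuous_finsetSum _ fun i _ => hg.continuous_fderiv _ _)

lemma hasCompactSupport_finset_sum {ι X : Type*} [TopologicalSpace X] (s : Finset ι)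
    {f : ι → X → ℝ} (hf : ∀ i, HasCompactSupport (f i)) :
    HasCompactSupport fun x => ∑ i ∈ s, f i x := by
  classical
  induction s using Finset.induction_on with
  | empty =>
    simp only [Finset.sum_empty]
    exact HasCompactSupport.zero
  | insert a s ha ih =>
    simp only [Finset.sum_insert ha]
    exact (hf a).add ih

lemma Admissible.hasCompactSupport_div (hg : Admissible n Ω g) : HasCompactSupport fun x =>
    ∑ i : Fin n, fderiv ℝ (g i.castSucc) x (EuclideanSpace.single i 1) :=
  hasCompactSupport_finset_sum _ fun i => (hg.2.1 i.castSucc).fderiv_apply (𝕜 := ℝ) _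

lemma Admissible.hasCompactSupport_testField (hg : Admissible n Ω g) :
    HasCompactSupport (testField g) :=
  (hg.2.1 _).add hg.hasCompactSupport_div

lemma Admissible.abs_le_one (hg : Admissible n Ω g) (i : Fin (n + 1))
    (x : EuclideanSpace ℝ (Fin n)) : |g i x| ≤ 1 := by
  rw [abs_le_one_iff_mul_self_le_one, ← sq]
  exact (Finset.single_le_sum (f := fun i => g i x ^ 2) (fun i _ => sq_nonneg _)
    (Finset.mem_univ i)).trans (hg.2.2.2 x)

lemma Admissible.testField_eq_zero (hg : Admissible n Ω g) {x : EuclideanSpace ℝ (Fin n)}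
    (hx : x ∉ Ω) : testField g x = 0 := by
  have h : ∀ i, x ∉ tsupport (g i) := fun i hi => hx (hg.2.2.1 i hi)
  have h' : ∀ i, fderiv ℝ (g i) x = 0 := fun i =>
    image_eq_zero_of_notMem_tsupport fun hi => h i (tsupport_fderiv_subset ℝ hi)
  simp [testField, h', image_eq_zero_of_notMem_tsupport (h _)]

end

section
variable {n : ℕ} {Ω : Set (EuclideanSpace ℝ (Fin n))}
  {g : Fin (n + 1) → EuclideanSpace ℝ (Fin n) → ℝ} {η u : EuclideanSpace ℝ (Fin n) → ℝ}

/-- Integration by parts against a `C¹` function composed with a function of one variable. -/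
lemma integral_mul_fderiv_comp_mul {ψ Ψ : ℝ → ℝ} (hψ : ContDiff ℝ 1 ψ)
    (hΨ : ∀ t, HasDerivAt Ψ (1 - ψ t) t) (hu : ContDiff ℝ 1 u)
    {f : EuclideanSpace ℝ (Fin n) → ℝ} (hf : ContDiff ℝ 1 f) (hfc : HasCompactSupport f)
    (w : EuclideanSpace ℝ (Fin n)) :
    ∫ x, u x * fderiv ℝ (fun y => (1 - ψ (u y)) * f y) x w =
      ∫ x, Ψ (u x) * fderiv ℝ f x w := by
  have hψu : ContDiff ℝ 1 fun y => 1 - ψ (u y) := contDiff_const.sub (hψ.comp hu)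
  have hF : ContDiff ℝ 1 fun y => (1 - ψ (u y)) * f y := hψu.mul hf
  have hFc : HasCompactSupport fun y => (1 - ψ (u y)) * f y := hfc.mul_left
  have hΨu : ∀ x, HasFDerivAt (fun y => Ψ (u y)) ((1 - ψ (u x)) • fderiv ℝ u x) x := fun x =>
    (hΨ (u x)).comp_hasFDerivAt x (hu.differentiable one_ne_zero x).hasFDerivAt
  have hΨc : Continuous fun y => Ψ (u y) :=
    continuous_iff_continuousAt.2 fun x => (hΨu x).continuousAt
  have hud : Continuous fun x => fderiv ℝ u x w :=
    (hu.continuous_fderiv one_ne_zero).clm_apply continuous_const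
  have hfd : Continuous fun x => fderiv ℝ f x w :=
    (hf.continuous_fderiv one_ne_zero).clm_apply continuous_const
  have hFd : Continuous fun x => fderiv ℝ (fun y => (1 - ψ (u y)) * f y) x w :=
    (hF.continuous_fderiv one_ne_zero).clm_apply continuous_const
  have hΨd : ∀ x, fderiv ℝ (fun y => Ψ (u y)) x w = (1 - ψ (u x)) * fderiv ℝ u x w := fun x => by
    rw [(hΨu x).fderiv]; simp
  have hkey : ∀ x, fderiv ℝ u x w * ((1 - ψ (u x)) * f x) =
      fderiv ℝ (fun y => Ψ (u y)) x w * f x := fun x => by rw [hΨd]; ring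
  have hint : Integrable fun x => fderiv ℝ u x w * ((1 - ψ (u x)) * f x) :=
    (hud.mul hF.continuous).integrable_of_hasCompactSupport hFc.mul_left
  rw [integral_mul_fderiv_eq_neg_fderiv_mul_of_integrable hint
      ((hu.continuous.mul hFd).integrable_of_hasCompactSupport
        (hFc.fderiv_apply (𝕜 := ℝ) w).mul_left)
      ((hu.continuous.mul hF.continuous).integrable_of_hasCompactSupport hFc.mul_left)
      (fun x _ => hu.differentiable one_ne_zero x) (fun x _ => hF.differentiable one_ne_zero x),
    integral_mul_fderiv_eq_neg_fderiv_mul_of_integrable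
      (by simpa only [hkey] using hint)
      ((hΨc.mul hfd).integrable_of_hasCompactSupport (hfc.fderiv_apply (𝕜 := ℝ) w).mul_left)
      ((hΨc.mul hf.continuous).integrable_of_hasCompactSupport hfc.mul_left)
      (fun x _ => (hΨu x).differentiableAt) (fun x _ => hf.differentiable one_ne_zero x)]
  simp only [hkey]

/-- A convex combination, with `C¹` weights, of an admissible family and a cutoff in the last
component. -/
lemma Admissible.convex_comb (hg : Admissible n Ω g) (hη : ContDiff ℝ 1 η)
    (hηc : HasCompactSupport η) (hηΩ : tsupport η ⊆ Ω) (hη0 : ∀ x, 0 ≤ η x) (hη1 : ∀ x, η x ≤ 1)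
    (hgη : ∀ i, tsupport (g i) ⊆ tsupport η) {s : EuclideanSpace ℝ (Fin n) → ℝ}
    (hs : ContDiff ℝ 1 s) (hs0 : ∀ x, 0 ≤ s x) (hs1 : ∀ x, s x ≤ 1) :
    let h : Fin (n + 1) → EuclideanSpace ℝ (Fin n) → ℝ := fun i x =>
      (1 - s x) * g i x + s x * (Pi.single (M := fun _ => ℝ) (Fin.last n) 1 i * η x)
    Admissible n Ω h ∧ ∀ i, tsupport (h i) ⊆ tsupport η := by
  intro h
  have hsupp : ∀ i, tsupport (h i) ⊆ tsupport η := fun i => by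
    refine closure_minimal (fun x hx => ?_) (isClosed_tsupport _)
    by_contra hxη
    have h1 : g i x = 0 := image_eq_zero_of_notMem_tsupport fun h' => hxη (hgη i h')
    have h2 : η x = 0 := image_eq_zero_of_notMem_tsupport hxη
    exact hx (by simp [h, h1, h2])
  refine ⟨⟨fun i => ?_, fun i => ?_, fun i => (hsupp i).trans hηΩ, fun x => ?_⟩, hsupp⟩
  · exact ((contDiff_const.sub hs).mul (hg.1 i)).add (hs.mul (contDiff_const.mul hη))
  · exact hηc.of_isClosed_subset (isClosed_tsupport _) (hsupp i)
  · have hsq : ∀ i, h i x ^ 2 ≤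
        (1 - s x) * g i x ^ 2 + s x * Pi.single (M := fun _ => ℝ) (Fin.last n) 1 i := fun i => by
      have hc : Pi.single (M := fun _ => ℝ) (Fin.last n) 1 i = 0 ∨
          Pi.single (M := fun _ => ℝ) (Fin.last n) 1 i = 1 := by
        by_cases hi : i = Fin.last n
        · subst hi; simp
        · simp [hi]
      set c := Pi.single (M := fun _ => ℝ) (Fin.last n) 1 i
      have hcc : (c * η x) ^ 2 ≤ c := by
        rcases hc with hc | hc <;> rw [hc]
        · simp
        · rw [one_mul]; exact pow_le_one₀ (hη0 x) (hη1 x)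
      have h1 : h i x ^ 2 ≤ (1 - s x) * g i x ^ 2 + s x * (c * η x) ^ 2 := by
        have : 0 ≤ (1 - s x) * s x * (g i x - c * η x) ^ 2 :=
          mul_nonneg (mul_nonneg (sub_nonneg.2 (hs1 x)) (hs0 x)) (sq_nonneg _)
        change ((1 - s x) * g i x + s x * (c * η x)) ^ 2 ≤ _
        nlinarith
      exact h1.trans (by gcongr; exact hs0 x)
    refine (Finset.sum_le_sum fun i _ => hsq i).trans ?_
    rw [Finset.sum_add_distrib, ← Finset.mul_sum, ← Finset.mul_sum]
    have : ∑ i, Pi.single (M := fun _ => ℝ) (Fin.last n) 1 i = 1 := by simp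
    rw [this]
    nlinarith [hg.2.2.2 x, hs1 x]

/-- The truncation estimate for a `C¹` function. -/
lemma integral_truncation_le_of_contDiff (hg : Admissible n Ω g) (hη : ContDiff ℝ 1 η)
    (hηc : HasCompactSupport η) (hηΩ : tsupport η ⊆ Ω) (hη1 : ∀ x, η x ≤ 1)
    (hgη : ∀ i, tsupport (g i) ⊆ tsupport η) (hglast : ∀ x, |g (Fin.last n) x| ≤ η x)
    (hu : ContDiff ℝ 1 u) (hu0 : ∀ x, 0 ≤ u x) {k M : ℝ} (hk : 0 < k)
    (hM : ∀ h, Admissible n Ω h → (∀ i, tsupport (h i) ⊆ tsupport η) →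
      ∫ x, u x * testField h x ≤ M) :
    ∫ x, (min (u x) k * testField g x + max (min (u x) (k + 1) - k) 0 * η x) ≤ M := by
  set D : EuclideanSpace ℝ (Fin n) → ℝ := fun x =>
    ∑ i : Fin n, fderiv ℝ (g i.castSucc) x (EuclideanSpace.single i 1) with hD
  have hη0 : ∀ x, 0 ≤ η x := fun x => (abs_nonneg _).trans (hglast x)
  have hDc : Continuous D := continuous_finsetSum _ fun i _ => hg.continuous_fderiv _ _
  have hDs : HasCompactSupport D := hg.hasCompactSupport_div
  have huc := hu.continuous
  have hE : Integrable fun x => |D x| + 2 * η x :=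
    (hDc.abs.integrable_of_hasCompactSupport hDs.abs).add
      ((hη.continuous.integrable_of_hasCompactSupport hηc).const_mul 2)
  have main : ∀ e : ℝ, 0 < e →
      ∫ x, (min (u x) k * testField g x + max (min (u x) (k + 1) - k) 0 * η x) ≤
        M + e * ∫ x, (|D x| + 2 * η x) := by
    intro e he
    obtain ⟨ψ, Ψ, hψ, hψ0, hψ1, hψz, hψo, hΨ, hΨl, hΨr⟩ := exists_smooth_truncation k he
    obtain ⟨hadm, hsupp⟩ := hg.convex_comb hη hηc hηΩ hη0 hη1 hgη (hψ.comp hu)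
      (fun x => hψ0 _) (fun x => hψ1 _)
    set h : Fin (n + 1) → EuclideanSpace ℝ (Fin n) → ℝ := fun i x =>
      (1 - (ψ ∘ u) x) * g i x + (ψ ∘ u) x * (Pi.single (M := fun _ => ℝ) (Fin.last n) 1 i * η x)
      with hh
    have hhi : ∀ i : Fin n, h i.castSucc = fun y => (1 - ψ (u y)) * g i.castSucc y := fun i => by
      funext y
      simp [hh]
    have hhl : ∀ x, h (Fin.last n) x =
        (1 - ψ (u x)) * g (Fin.last n) x + ψ (u x) * η x := fun x => by simp [hh]
    have hΨu : Continuous fun x => Ψ (u x) :=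
      (continuous_iff_continuousAt.2 fun t => (hΨ t).continuousAt).comp huc
    have hI1 : Integrable fun x => u x * h (Fin.last n) x :=
      (huc.mul (hadm.1 _).continuous).integrable_of_hasCompactSupport (hadm.2.1 _).mul_left
    have hI2 : ∀ i : Fin n, Integrable fun x =>
        u x * fderiv ℝ (h i.castSucc) x (EuclideanSpace.single i 1) := fun i =>
      (huc.mul (hadm.continuous_fderiv _ _)).integrable_of_hasCompactSupport
        ((hadm.2.1 _).fderiv_apply (𝕜 := ℝ) _).mul_left
    have hI3 : ∀ i : Fin n, Integrable fun x =>
        Ψ (u x) * fderiv ℝ (g i.castSucc) x (EuclideanSpace.single i 1) := fun i =>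
      (hΨu.mul (hg.continuous_fderiv _ _)).integrable_of_hasCompactSupport
        ((hg.2.1 _).fderiv_apply (𝕜 := ℝ) _).mul_left
    have hI4 : Integrable fun x => Ψ (u x) * D x :=
      (hΨu.mul hDc).integrable_of_hasCompactSupport hDs.mul_left
    have hI5 : Integrable fun x => u x * h (Fin.last n) x + Ψ (u x) * D x := hI1.add hI4
    have heq : ∫ x, u x * testField h x = ∫ x, (u x * h (Fin.last n) x + Ψ (u x) * D x) := by
      simp only [testField, mul_add, Finset.mul_sum, hD]
      rw [integral_add hI1 (integrable_finsetSum _ fun i _ => hI2 i),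
        integral_add hI1 (integrable_finsetSum _ fun i _ => hI3 i),
        integral_finsetSum _ fun i _ => hI2 i, integral_finsetSum _ fun i _ => hI3 i]
      congr 1
      refine Finset.sum_congr rfl fun i _ => ?_
      rw [hhi]
      exact integral_mul_fderiv_comp_mul hψ hΨ hu (hg.1 _) (hg.2.1 _) _
    have hle := hM h hadm hsupp
    rw [heq] at hle
    calc _ ≤ ∫ x, ((u x * h (Fin.last n) x + Ψ (u x) * D x) + e * (|D x| + 2 * η x)) := by
          refine integral_mono ?_ (hI5.add (hE.const_mul e)) fun x => ?_
          · exact (((huc.min continuous_const).mul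
              hg.continuous_testField).integrable_of_hasCompactSupport
                hg.hasCompactSupport_testField.mul_left).add
              (((((huc.min continuous_const).sub continuous_const).max continuous_const).mul
                hη.continuous).integrable_of_hasCompactSupport hηc.mul_left)
          · have := truncation_pointwise_le (D := D x) hk he (hu0 x) (hψ0 (u x)) (hψ1 (u x))
              (hψz _) (hψo _) (hΨl _) (hΨr _) (hglast x)
            simp only [hhl]
            exact this
      _ = (∫ x, (u x * h (Fin.last n) x + Ψ (u x) * D x)) + e * ∫ x, (|D x| + 2 * η x) := by
          rw [integral_add hI5 (hE.const_mul e), integral_const_mul]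
      _ ≤ _ := by linarith
  have hlim : Tendsto (fun e : ℝ => M + e * ∫ x, (|D x| + 2 * η x)) (𝓝[>] 0) (𝓝 M) := by
    have : Tendsto (fun e : ℝ => M + e * ∫ x, (|D x| + 2 * η x)) (𝓝 0)
        (𝓝 (M + 0 * ∫ x, (|D x| + 2 * η x))) := by
      apply Continuous.tendsto
      fun_prop
    rw [zero_mul, add_zero] at this
    exact this.mono_left nhdsWithin_le_nhds
  exact ge_of_tendsto hlim (by filter_upwards [self_mem_nhdsWithin] with e he using main e he)

end

section
variable {n : ℕ} {Ω : Set (EuclideanSpace ℝ (Fin n))}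
  {g : Fin (n + 1) → EuclideanSpace ℝ (Fin n) → ℝ}

/-- Mollification of `f` by the normalized bump function `φ`. -/
noncomputable def mollify (φ : ContDiffBump (0 : EuclideanSpace ℝ (Fin n)))
    (f : EuclideanSpace ℝ (Fin n) → ℝ) : EuclideanSpace ℝ (Fin n) → ℝ :=
  φ.normed volume ⋆[ContinuousLinearMap.lsmul ℝ ℝ, volume] f

variable (φ : ContDiffBump (0 : EuclideanSpace ℝ (Fin n)))

lemma mollify_apply (f : EuclideanSpace ℝ (Fin n) → ℝ) (x : EuclideanSpace ℝ (Fin n)) :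
    mollify φ f x = ∫ t, φ.normed volume t * f (x - t) := rfl

lemma mollify_apply_swap (f : EuclideanSpace ℝ (Fin n) → ℝ) (x : EuclideanSpace ℝ (Fin n)) :
    mollify φ f x = ∫ t, φ.normed volume (x - t) * f t := by
  rw [mollify, convolution_eq_swap]
  rfl

lemma contDiff_mollify_of_integrable {f : EuclideanSpace ℝ (Fin n) → ℝ} (hf : Integrable f) :
    ContDiff ℝ 1 (mollify φ f) :=
  φ.hasCompactSupport_normed.contDiff_convolution_left _ φ.contDiff_normed hf.locallyIntegrable

lemma contDiff_mollify {f : EuclideanSpace ℝ (Fin n) → ℝ} (hf : ContDiff ℝ 1 f)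
    (hfc : HasCompactSupport f) : ContDiff ℝ 1 (mollify φ f) :=
  contDiff_mollify_of_integrable φ (hf.continuous.integrable_of_hasCompactSupport hfc)

lemma fderiv_mollify {f : EuclideanSpace ℝ (Fin n) → ℝ} (hf : ContDiff ℝ 1 f)
    (hfc : HasCompactSupport f) (x w : EuclideanSpace ℝ (Fin n)) :
    fderiv ℝ (mollify φ f) x w = mollify φ (fun y => fderiv ℝ f y w) x := by
  have hφ : LocallyIntegrable (φ.normed (volume : Measure (EuclideanSpace ℝ (Fin n)))) :=
    φ.continuous_normed.locallyIntegrable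
  rw [mollify, (hfc.hasFDerivAt_convolution_right _ hφ hf x).fderiv,
    convolution_precompR_apply _ hφ (hfc.fderiv ℝ) (hf.continuous_fderiv one_ne_zero)]
  rfl

lemma tsupport_mollify_subset {f : EuclideanSpace ℝ (Fin n) → ℝ}
    {K : Set (EuclideanSpace ℝ (Fin n))} {δ : ℝ} (hK : tsupport f ⊆ K) (hδ : φ.rOut ≤ δ) :
    tsupport (mollify φ f) ⊆ Metric.cthickening δ K := by
  refine closure_minimal (fun x hx => ?_) Metric.isClosed_cthickening
  obtain ⟨a, ha, b, hb, rfl⟩ := support_convolution_subset _ hx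
  rw [φ.support_normed_eq, mem_ball_zero_iff] at ha
  refine Metric.mem_cthickening_of_dist_le _ b δ K (hK (subset_tsupport _ hb)) ?_
  simpa using ha.le.trans hδ

/-- Mollification is self-adjoint. -/
lemma integral_mul_mollify {V f : EuclideanSpace ℝ (Fin n) → ℝ} (hV : Integrable V)
    (hf : Integrable f) :
    ∫ x, V x * mollify φ f x = ∫ x, mollify φ V x * f x := by
  have hint : Integrable (Function.uncurry fun x y => φ.normed volume (x - y) * (V x * f y))
      (volume.prod volume) := by
    obtain ⟨C, hC⟩ := φ.continuous_normed.bounded_above_of_compact_support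
      (φ.hasCompactSupport_normed (μ := (volume : Measure (EuclideanSpace ℝ (Fin n)))))
    refine (hV.mul_prod hf).bdd_mul (c := C) ?_ (ae_of_all _ fun z => hC _)
    exact (φ.continuous_normed.comp (continuous_fst.sub continuous_snd)).aestronglyMeasurable
  calc ∫ x, V x * mollify φ f x
      = ∫ x, ∫ y, φ.normed volume (x - y) * (V x * f y) := by
        refine integral_congr_ae (ae_of_all _ fun x => ?_)
        simp only
        rw [mollify_apply_swap, ← integral_const_mul]
        exact integral_congr_ae (ae_of_all _ fun y => by simp only; ring)
    _ = ∫ y, ∫ x, φ.normed volume (x - y) * (V x * f y) := integral_integral_swap hint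
    _ = ∫ x, mollify φ V x * f x := by
        refine integral_congr_ae (ae_of_all _ fun y => ?_)
        simp only
        rw [mollify_apply_swap, ← integral_mul_const]
        refine integral_congr_ae (ae_of_all _ fun x => ?_)
        simp only
        rw [← φ.normed_neg (x - y), neg_sub]
        ring

lemma Admissible.mollify (hg : Admissible n Ω g) {K : Set (EuclideanSpace ℝ (Fin n))} {δ : ℝ}
    (hK : IsCompact K) (hgK : ∀ i, tsupport (g i) ⊆ K) (hδ : φ.rOut ≤ δ)
    (hKΩ : Metric.cthickening δ K ⊆ Ω) : Admissible n Ω fun i => mollify φ (g i) := by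
  have hsupp := fun i => tsupport_mollify_subset φ (hgK i) hδ
  refine ⟨fun i => contDiff_mollify φ (hg.1 i) (hg.2.1 i), fun i => ?_,
    fun i => (hsupp i).trans hKΩ, fun x => ?_⟩
  · exact hK.cthickening.of_isClosed_subset (isClosed_tsupport _) (hsupp i)
  · set c : Fin (n + 1) → ℝ := fun i => _root_.mollify φ (g i) x with hc
    have hφi : Integrable (φ.normed (volume : Measure (EuclideanSpace ℝ (Fin n)))) :=
      φ.integrable_normed
    have hi : ∀ i, Integrable fun t => c i * (φ.normed volume t * g i (x - t)) := fun i => by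
      refine Integrable.const_mul ?_ _
      refine (φ.continuous_normed.mul ((hg.1 i).continuous.comp
        (continuous_const.sub continuous_id))).integrable_of_hasCompactSupport
        φ.hasCompactSupport_normed.mul_right
    have h1 : ∑ i, c i ^ 2 = ∫ t, ∑ i, c i * (φ.normed volume t * g i (x - t)) := by
      rw [integral_finsetSum _ fun i _ => hi i]
      refine Finset.sum_congr rfl fun i _ => ?_
      rw [integral_const_mul, ← mollify_apply, sq]
    have h2 : ∫ t, ∑ i, c i * (φ.normed volume t * g i (x - t)) ≤
        ∫ t, φ.normed volume t * ((∑ i, c i ^ 2 + 1) / 2) := by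
      refine integral_mono (integrable_finsetSum _ fun i _ => hi i) (hφi.mul_const _) fun t => ?_
      have h3 : ∑ i, c i * g i (x - t) ≤ (∑ i, c i ^ 2 + 1) / 2 := by
        have : ∑ i, c i * g i (x - t) ≤ ∑ i, (c i ^ 2 + g i (x - t) ^ 2) / 2 :=
          Finset.sum_le_sum fun i _ => by nlinarith [sq_nonneg (c i - g i (x - t))]
        rw [← Finset.sum_div, Finset.sum_add_distrib] at this
        linarith [hg.2.2.2 (x - t)]
      calc _ = φ.normed volume t * ∑ i, c i * g i (x - t) := by
            rw [Finset.mul_sum]; exact Finset.sum_congr rfl fun i _ => by ring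
        _ ≤ _ := mul_le_mul_of_nonneg_left h3 (φ.nonneg_normed t)
    rw [integral_mul_const, φ.integral_normed, one_mul, ← h1] at h2
    linarith

lemma Admissible.testField_mollify (hg : Admissible n Ω g) :
    testField (fun i => _root_.mollify φ (g i)) = _root_.mollify φ (testField g) := by
  funext x
  have hint : ∀ f : EuclideanSpace ℝ (Fin n) → ℝ, Continuous f →
      Integrable fun t => φ.normed volume t * f (x - t) := fun f hf =>
    (φ.continuous_normed.mul (hf.comp
      (continuous_const.sub continuous_id))).integrable_of_hasCompactSupport
      φ.hasCompactSupport_normed.mul_right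
  simp only [testField, fderiv_mollify φ (hg.1 _) (hg.2.1 _), mollify_apply, mul_add,
    Finset.mul_sum]
  rw [integral_add (hint _ (hg.1 _).continuous)
      (integrable_finsetSum _ fun i _ => hint _ (hg.continuous_fderiv _ _)),
    integral_finsetSum _ fun i _ => hint _ (hg.continuous_fderiv _ _)]

lemma Admissible.integrable_testField (hg : Admissible n Ω g) : Integrable (testField g) :=
  hg.continuous_testField.integrable_of_hasCompactSupport hg.hasCompactSupport_testField

/-- The truncation estimate: the functional gains at least the mass of the part of `V` between
`k` and `k + 1`, as seen by the cutoff `η`. -/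
lemma integral_truncation_le {η V : EuclideanSpace ℝ (Fin n) → ℝ} (hΩ : IsOpen Ω)
    (hg : Admissible n Ω g) (hη : ContDiff ℝ 1 η)
    (hηc : HasCompactSupport η) (hηΩ : tsupport η ⊆ Ω) (hη1 : ∀ x, η x ≤ 1)
    (hgη : ∀ i, tsupport (g i) ⊆ tsupport η) (hglast : ∀ x, |g (Fin.last n) x| ≤ η x)
    (hV : Integrable V) (hV0 : ∀ x, 0 ≤ V x) {k M : ℝ} (hk : 0 < k)
    (hM : ∀ h, Admissible n Ω h → ∫ x, V x * testField h x ≤ M) :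
    ∫ x, (min (V x) k * testField g x + max (min (V x) (k + 1) - k) 0 * η x) ≤ M := by
  obtain ⟨δ, hδ, hδΩ⟩ := IsCompact.exists_cthickening_subset_open (hηc : IsCompact (tsupport η))
    hΩ hηΩ
  let φ : ℕ → ContDiffBump (0 : EuclideanSpace ℝ (Fin n)) := fun m =>
    { rIn := δ / (m + 1) / 2
      rOut := δ / (m + 1)
      rIn_pos := by positivity
      rIn_lt_rOut := half_lt_self (by positivity) }
  have hφδ : ∀ m, (φ m).rOut ≤ δ := fun m =>
    div_le_self hδ.le (by linarith [(Nat.cast_nonneg m : (0 : ℝ) ≤ m)])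
  have hφ0 : Tendsto (fun m => (φ m).rOut) atTop (𝓝 0) := by
    simpa [φ, Function.comp_def] using
      (tendsto_const_div_atTop_nhds_zero_nat δ).comp (tendsto_add_atTop_nat 1)
  have hae : ∀ᵐ x, Tendsto (fun m => mollify (φ m) V x) atTop (𝓝 (V x)) :=
    ContDiffBump.ae_convolution_tendsto_right_of_locallyIntegrable (K := 2) hφ0
      (Eventually.of_forall fun m => by
        change δ / (m + 1) ≤ 2 * (δ / (m + 1) / 2)
        linarith) hV.locallyIntegrable
  have hVm : ∀ m, ContDiff ℝ 1 (mollify (φ m) V) := fun m => contDiff_mollify_of_integrable _ hV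
  have hVm0 : ∀ m x, 0 ≤ mollify (φ m) V x := fun m x =>
    integral_nonneg fun t => mul_nonneg ((φ m).nonneg_normed t) (hV0 _)
  have hη0 : ∀ x, 0 ≤ η x := fun x => (abs_nonneg _).trans (hglast x)
  have hstep : ∀ m, ∫ x, (min (mollify (φ m) V x) k * testField g x +
      max (min (mollify (φ m) V x) (k + 1) - k) 0 * η x) ≤ M := fun m => by
    refine integral_truncation_le_of_contDiff hg hη hηc hηΩ hη1 hgη hglast (hVm m) (hVm0 m) hk
      fun h hh hhη => ?_
    rw [← integral_mul_mollify _ hV hh.integrable_testField, ← hh.testField_mollify]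
    exact hM _ (hh.mollify _ hηc hhη (hφδ m) hδΩ)
  refine le_of_tendsto (tendsto_integral_of_dominated_convergence
    (fun x => k * |testField g x| + η x) (fun m => ?_) ?_ (fun m => ?_) ?_)
    (Eventually.of_forall hstep)
  · have := (hVm m).continuous
    have := hg.continuous_testField
    have := hη.continuous
    exact Continuous.aestronglyMeasurable (by fun_prop)
  · exact (hg.integrable_testField.abs.const_mul k).add
      (hη.continuous.integrable_of_hasCompactSupport hηc)
  · refine ae_of_all _ fun x => ?_
    have h0 := hVm0 m x
    refine (norm_add_le _ _).trans (add_le_add ?_ ?_)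
    · rw [Real.norm_eq_abs, abs_mul, abs_of_nonneg (le_min h0 hk.le)]
      exact mul_le_mul_of_nonneg_right (min_le_right _ _) (abs_nonneg _)
    · rw [Real.norm_eq_abs, abs_of_nonneg (mul_nonneg (le_max_right _ _) (hη0 x))]
      refine mul_le_of_le_one_left (hη0 x) (max_le ?_ zero_le_one)
      linarith [min_le_right (mollify (φ m) V x) (k + 1)]
  · filter_upwards [hae] with x hx
    have hc : Continuous fun t : ℝ =>
        min t k * testField g x + max (min t (k + 1) - k) 0 * η x := by fun_prop
    exact (hc.tendsto _).comp hx

end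

section
variable {n : ℕ} {Ω : Set (EuclideanSpace ℝ (Fin n))}
  {g : Fin (n + 1) → EuclideanSpace ℝ (Fin n) → ℝ} {v : EuclideanSpace ℝ (Fin n) → ℝ}

open scoped Manifold ContDiff in
/-- A `C¹` cutoff which is `1` on a compact subset of an open set. -/
lemma exists_cutoff (hΩ : IsOpen Ω) {K : Set (EuclideanSpace ℝ (Fin n))} (hK : IsCompact K)
    (hKΩ : K ⊆ Ω) : ∃ η : EuclideanSpace ℝ (Fin n) → ℝ, ContDiff ℝ 1 η ∧ HasCompactSupport η ∧
      tsupport η ⊆ Ω ∧ (∀ x, 0 ≤ η x) ∧ (∀ x, η x ≤ 1) ∧ ∀ x ∈ K, η x = 1 := by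
  obtain ⟨L, hL, hKL, hLΩ⟩ := exists_compact_between hK hΩ hKΩ
  obtain ⟨f, hf1, hf0, hf⟩ := exists_contMDiffMap_one_nhds_of_subset_interior
    (n := 1) 𝓘(ℝ, EuclideanSpace ℝ (Fin n)) hK.isClosed hKL
  have hsupp : tsupport f ⊆ L := closure_minimal
    (fun x hx => by_contra fun hxL => hx (hf0 x hxL)) hL.isClosed
  exact ⟨f, f.contMDiff.contDiff, hL.of_isClosed_subset (isClosed_tsupport _) hsupp,
    hsupp.trans hLΩ, fun x => (hf x).1, fun x => (hf x).2, fun x hx => hf1.self_of_nhdsSet x hx⟩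

/-- Replacing the last component by zero keeps a family admissible. -/
lemma Admissible.zero_last (hg : Admissible n Ω g) :
    Admissible n Ω fun i => if i = Fin.last n then 0 else g i := by
  refine ⟨fun i => ?_, fun i => ?_, fun i => ?_, fun x => ?_⟩
  · dsimp only; split_ifs
    exacts [contDiff_const, hg.1 i]
  · dsimp only; split_ifs
    exacts [HasCompactSupport.zero, hg.2.1 i]
  · dsimp only; split_ifs
    exacts [by simp [tsupport], hg.2.2.1 i]
  · refine (Finset.sum_le_sum fun i _ => ?_).trans (hg.2.2.2 x)
    dsimp only; split_ifs
    · simpa using sq_nonneg (g i x)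
    · exact le_rfl

lemma admissible_zero : Admissible n Ω fun _ _ => 0 :=
  ⟨fun _ => contDiff_const, fun _ => HasCompactSupport.zero, fun _ => by simp [tsupport],
    fun _ => by simp⟩

lemma integrableOn_mul_of_hasCompactSupport (hv : IntegrableOn v Ω)
    {f : EuclideanSpace ℝ (Fin n) → ℝ} (hf : Continuous f) (hfc : HasCompactSupport f) :
    IntegrableOn (fun x => v x * f x) Ω := by
  obtain ⟨C, hC⟩ := hf.bounded_above_of_compact_support hfc
  exact Integrable.mul_bdd (c := C) hv hf.aestronglyMeasurable (ae_of_all _ hC)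

lemma Ffun_lt_top_of_Afun_lt_top (hv : IntegrableOn v Ω) (hA : Afun n Ω v < ⊤) :
    Ffun n Ω v < ⊤ := by
  refine lt_of_le_of_lt (iSup_le fun ⟨g, hg⟩ => ?_)
    (ENNReal.add_lt_top.2 ⟨ENNReal.ofReal_lt_top (r := ∫ x in Ω, |v x|), hA⟩)
  simp only [mul_add]
  rw [integral_add
    (integrableOn_mul_of_hasCompactSupport hv (hg.1 _).continuous (hg.2.1 _))
    (integrableOn_mul_of_hasCompactSupport hv
      (continuous_finsetSum _ fun i _ => hg.continuous_fderiv _ _) hg.hasCompactSupport_div)]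
  refine ENNReal.ofReal_add_le.trans (add_le_add (ENNReal.ofReal_le_ofReal ?_) ?_)
  · refine integral_mono
      (integrableOn_mul_of_hasCompactSupport hv (hg.1 _).continuous (hg.2.1 _)) hv.abs fun x => ?_
    calc v x * g (Fin.last n) x ≤ |v x| * |g (Fin.last n) x| := by
          rw [← abs_mul]; exact le_abs_self _
      _ ≤ |v x| := mul_le_of_le_one_right (abs_nonneg _) (hg.abs_le_one _ x)
  · refine le_of_eq_of_le ?_ (le_iSup _ ⟨_, hg.zero_last⟩)
    simp [Fin.castSucc_ne_last]

lemma Afun_lt_top_of_Ffun_lt_top (hv : IntegrableOn v Ω) (hΩ : volume Ω < ⊤)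
    (hF : Ffun n Ω v < ⊤) : Afun n Ω v < ⊤ := by
  have : IsFiniteMeasure (volume.restrict Ω) := ⟨by simpa using hΩ⟩
  refine lt_of_le_of_lt (iSup_le fun ⟨g, hg⟩ => ?_)
    (ENNReal.add_lt_top.2 ⟨ENNReal.ofReal_lt_top (r := ∫ _ in Ω, (1 : ℝ)), hF⟩)
  have hg0 : IntegrableOn (g (Fin.last n)) Ω :=
    ((hg.1 _).continuous.integrable_of_hasCompactSupport (hg.2.1 _)).integrableOn
  simp only
  rw [integral_add hg0 (integrableOn_mul_of_hasCompactSupport hv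
      (continuous_finsetSum _ fun i _ => hg.continuous_fderiv _ _) hg.hasCompactSupport_div)]
  refine ENNReal.ofReal_add_le.trans (add_le_add (ENNReal.ofReal_le_ofReal ?_) ?_)
  · exact integral_mono hg0 (integrable_const _) fun x => (abs_le.1 (hg.abs_le_one _ x)).2
  · refine le_of_eq_of_le ?_ (le_iSup _ ⟨_, hg.zero_last⟩)
    simp [Fin.castSucc_ne_last]

/-- Truncating `v` at height `k` lowers the functional by at least the mass of the slab of `v`
between the heights `k` and `k + 1` over any compact subset of `Ω`. -/
lemma setIntegral_truncation_add_le (hΩo : IsOpen Ω) (hv : IntegrableOn v Ω)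
    (hpos : ∀ᵐ x ∂(volume.restrict Ω), 0 ≤ v x) (hF : Ffun n Ω v < ⊤) {k : ℝ} (hk : 0 < k)
    {K : Set (EuclideanSpace ℝ (Fin n))} (hK : IsCompact K) (hKΩ : K ⊆ Ω)
    (hg : Admissible n Ω g) :
    (∫ x in Ω, min (v x) k * testField g x) + (∫ x in K, max (min (v x) (k + 1) - k) 0) ≤
      (Ffun n Ω v).toReal := by
  set V : EuclideanSpace ℝ (Fin n) → ℝ := Ω.indicator fun x => max (v x) 0 with hVdef
  have hV0 : ∀ x, 0 ≤ V x := indicator_nonneg fun x _ => le_max_right _ _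
  have hVi : Integrable V := IntegrableOn.integrable_indicator (Integrable.pos_part hv) hΩo.measurableSet
  have hVv : ∀ᵐ x ∂(volume.restrict Ω), V x = v x := by
    filter_upwards [hpos, ae_restrict_mem hΩo.measurableSet] with x hx hxΩ
    simp [hVdef, hxΩ, hx]
  have hM : ∀ h, Admissible n Ω h → ∫ x, V x * testField h x ≤ (Ffun n Ω v).toReal := by
    intro h hh
    have h1 : ∫ x, V x * testField h x = ∫ x in Ω, v x * testField h x := by
      rw [← setIntegral_eq_integral_of_forall_compl_eq_zero (s := Ω)
        fun x hx => by rw [hh.testField_eq_zero hx, mul_zero]]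
      exact integral_congr_ae (hVv.mono fun x hx => by simp only [hx])
    rw [h1, ← ENNReal.ofReal_le_iff_le_toReal hF.ne]
    exact le_iSup (fun h : { h // Admissible n Ω h } =>
      ENNReal.ofReal (∫ x in Ω, v x * testField h.1 x)) ⟨h, hh⟩
  obtain ⟨η, hη, hηc, hηΩ, hη0, hη1, hηK⟩ := exists_cutoff hΩo
    (hK.union (isCompact_iUnion fun i => hg.2.1 i))
    (union_subset hKΩ (iUnion_subset hg.2.2.1))
  have hη_one : ∀ i, ∀ x ∈ tsupport (g i), η x = 1 := fun i x hx =>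
    hηK x (Or.inr (mem_iUnion.2 ⟨i, hx⟩))
  have hgη : ∀ i, tsupport (g i) ⊆ tsupport η := fun i x hx =>
    subset_tsupport _ (by simp [hη_one i x hx])
  have hglast : ∀ x, |g (Fin.last n) x| ≤ η x := fun x => by
    by_cases hx : x ∈ tsupport (g (Fin.last n))
    · rw [hη_one _ x hx]; exact hg.abs_le_one _ x
    · rw [image_eq_zero_of_notMem_tsupport hx, abs_zero]; exact hη0 x
  have hmain := integral_truncation_le hΩo hg hη hηc hηΩ hη1 hgη hglast hVi hV0 hk hM
  have hηi : Integrable η := hη.continuous.integrable_of_hasCompactSupport hηc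
  have hI1 : Integrable fun x => min (V x) k * testField g x := by
    refine hg.integrable_testField.bdd_mul (c := k)
      (hVi.aestronglyMeasurable.inf aestronglyMeasurable_const) (ae_of_all _ fun x => ?_)
    rw [Real.norm_eq_abs, abs_of_nonneg (le_min (hV0 x) hk.le)]
    exact min_le_right _ _
  have hI2 : Integrable fun x => max (min (V x) (k + 1) - k) 0 * η x := by
    refine hηi.bdd_mul (c := 1) (((hVi.aestronglyMeasurable.inf
      aestronglyMeasurable_const).sub aestronglyMeasurable_const).sup
        aestronglyMeasurable_const) (ae_of_all _ fun x => ?_)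
    rw [Real.norm_eq_abs, abs_of_nonneg (le_max_right _ _)]
    exact max_le (by linarith [min_le_right (V x) (k + 1)]) zero_le_one
  rw [integral_add hI1 hI2] at hmain
  have h1 : ∫ x, min (V x) k * testField g x = ∫ x in Ω, min (v x) k * testField g x := by
    rw [← setIntegral_eq_integral_of_forall_compl_eq_zero (s := Ω)
      fun x hx => by rw [hg.testField_eq_zero hx, mul_zero]]
    exact integral_congr_ae (hVv.mono fun x hx => by simp only [hx])
  have h2 : ∫ x in K, max (min (v x) (k + 1) - k) 0 ≤
      ∫ x, max (min (V x) (k + 1) - k) 0 * η x := by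
    calc _ = ∫ x in K, max (min (V x) (k + 1) - k) 0 * η x := by
          refine integral_congr_ae ?_
          filter_upwards [ae_restrict_of_ae_restrict_of_subset hKΩ hVv,
            ae_restrict_mem hK.measurableSet] with x hx hxK
          rw [hx, hηK x (Or.inl hxK), mul_one]
      _ ≤ _ := setIntegral_le_integral hI2
          (ae_of_all _ fun x => mul_nonneg (le_max_right _ _) (hη0 x))
  rw [h1] at hmain
  linarith

lemma exists_isCompact_setIntegral_slab_pos (hΩo : IsOpen Ω) (hv : IntegrableOn v Ω) {k : ℝ}
    (h : 0 < volume {x | x ∈ Ω ∧ k < v x}) :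
    ∃ K ⊆ Ω, IsCompact K ∧ 0 < ∫ x in K, max (min (v x) (k + 1) - k) 0 := by
  obtain ⟨x, hx, hxn⟩ := exists_mem_forall_mem_nhdsWithin_pos_measure h.ne'
  obtain ⟨r, hr, hrΩ⟩ := Metric.nhds_basis_closedBall.mem_iff.1 (hΩo.mem_nhds hx.1)
  have hK := isCompact_closedBall x r
  have : IsFiniteMeasure (volume.restrict (Metric.closedBall x r)) :=
    ⟨by simpa using hK.measure_lt_top⟩
  have hvK : IntegrableOn v (Metric.closedBall x r) := hv.mono_set hrΩ
  refine ⟨Metric.closedBall x r, hrΩ, hK, ?_⟩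
  have hint : IntegrableOn (fun x => max (min (v x) (k + 1) - k) 0) (Metric.closedBall x r) :=
    ((hvK.inf (integrable_const _)).sub (integrable_const _)).sup (integrable_const _)
  rw [setIntegral_pos_iff_support_of_nonneg_ae 
    (ae_of_all _ fun y => le_max_right (min (v y) (k + 1) - k) 0) hint]
  refine (hxn _ (inter_mem_nhdsWithin _ (Metric.closedBall_mem_nhds x hr))).trans_le
    (measure_mono fun y hy => ⟨?_, hy.2⟩)
  have h1 : 0 < min (v y) (k + 1) - k := sub_pos.2 (lt_min hy.1.2 (by linarith))
  exact (lt_max_of_lt_left h1).ne'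

end

/-- for `v ∈ BV⁺(Ω)`, every truncation `min(v, k)` (for `k > 0`)
belongs to `BV⁺(Ω)`, and for almost every `k > 0` such that
`A(k) = {x ∈ Ω : v x > k}` has positive measure, `F(min(v,k)) < F(v)`. -/
theorem stmt_12 (n : ℕ) (Ω : Set (EuclideanSpace ℝ (Fin n)))
    (hΩo : IsOpen Ω) (hΩb : Bornology.IsBounded Ω)
    (v : EuclideanSpace ℝ (Fin n) → ℝ)
    (hv : IntegrableOn v Ω) (hA : Afun n Ω v < ⊤)
    (hpos : ∀ᵐ x ∂(volume.restrict Ω), 0 ≤ v x) :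
    (∀ k : ℝ, 0 < k →
      IntegrableOn (fun x => min (v x) k) Ω ∧
      Afun n Ω (fun x => min (v x) k) < ⊤ ∧
      (∀ᵐ x ∂(volume.restrict Ω), 0 ≤ min (v x) k)) ∧
    (∀ᵐ k ∂(volume.restrict (Set.Ioi (0 : ℝ))),
      0 < volume {x | x ∈ Ω ∧ k < v x} →
        Ffun n Ω (fun x => min (v x) k) < Ffun n Ω v) := by
  have hF := Ffun_lt_top_of_Afun_lt_top hv hA
  have hΩfin : volume Ω < ⊤ := hΩb.measure_lt_top
  have : IsFiniteMeasure (volume.restrict Ω) := ⟨by simpa using hΩfin⟩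
  refine ⟨fun k hk => ?_, ?_⟩
  · have hint : IntegrableOn (fun x => min (v x) k) Ω := hv.inf (integrable_const k)
    refine ⟨hint, Afun_lt_top_of_Ffun_lt_top hint hΩfin ?_,
      hpos.mono fun x hx => le_min hx hk.le⟩
    refine lt_of_le_of_lt (iSup_le fun ⟨g, hg⟩ => ?_) hF
    have h := setIntegral_truncation_add_le hΩo hv hpos hF hk isCompact_empty
      (empty_subset _) hg
    rw [setIntegral_empty, add_zero] at h
    exact ENNReal.ofReal_le_of_le_toReal h
  · filter_upwards [ae_restrict_mem measurableSet_Ioi] with k (hk : 0 < k) hvol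
    obtain ⟨K, hKΩ, hK, hδ⟩ := exists_isCompact_setIntegral_slab_pos hΩo hv hvol
    have key := fun g (hg : Admissible n Ω g) =>
      setIntegral_truncation_add_le hΩo hv hpos hF hk hK hKΩ hg
    set δ := ∫ x in K, max (min (v x) (k + 1) - k) 0
    have hδF : δ ≤ (Ffun n Ω v).toReal := by
      simpa [testField] using key _ admissible_zero
    calc Ffun n Ω (fun x => min (v x) k)
        ≤ ENNReal.ofReal ((Ffun n Ω v).toReal - δ) :=
          iSup_le fun ⟨g, hg⟩ => ENNReal.ofReal_le_ofReal (le_sub_iff_add_le.2 (key g hg))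
      _ < ENNReal.ofReal (Ffun n Ω v).toReal :=
          (ENNReal.ofReal_lt_ofReal_iff (by linarith)).2 (by linarith)
      _ = Ffun n Ω v := ENNReal.ofReal_toReal hF.ne
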